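/- Assume N is even, N ≥ 6. Let U be an open subset of the upper half-plane {Im t > 0} such that for every t ∈ U one has ⟨L_{N−1},L_{N−2}⟩₁(t)·⟨L_{N−3},L_{N−4}⟩₁(t) ≠ 0 (the skew product depends on t through the weight w). For 0 ≤ j ≤ N−3 let r_j be monic polynomials of degree j not depending on t, and let r_{N−2}(·;t) = π_{N−2,1} and r_{N−1}(·;t) = π_{N−1,1} be the monic skew-orthogonal polynomials for the weight w(·;t). Let D(t) be the N×N matrix with entries ⟨r_j, r_k⟩₁(t). Then for every t ∈ U the matrix D(t) is invertible, the function t ↦ det D(t) is complex-differentiable on U, and (d/dt) det D(t) = −det D(t) · ∫₀^∞ S₁(x,x;t)/(t−x) dx, where S₁(x,x;t) = −Σ_{j,k=0}^{N−1} r_j(x;t)·w(x;t)·(D(t)^{−1})_{jk}·ε(r_k(·;t)·w(·;t))(x). -/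

import Mathlib

open MeasureTheory Polynomial Set

noncomputable section

/-- The weight `w(x) = e^{−Mx/2}·x^{(M−N−1)/2}·(t−x)^{−1/2}` on `(0,∞)`,
using the principal branch of the complex power. -/
def wC (M N : ℕ) (t : ℂ) (x : ℝ) : ℂ :=
  Complex.exp (-(M : ℂ) * x / 2) * (x : ℂ) ^ (((((M : ℝ) - N - 1) / 2 : ℝ)) : ℂ) *
    (t - x) ^ (-(1 / 2) : ℂ)

/-- The Laguerre weight `w₀(x) = x^{M−N}·e^{−Mx}`. -/
def w0R (M N : ℕ) (x : ℝ) : ℝ := x ^ (M - N) * Real.exp (-(M : ℝ) * x)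

/-- The skew product `⟨f,g⟩₁ = ∫₀^∞∫₀^∞ (1/2)·sgn(x−y)·f(x)·g(y)·w(x)·w(y) dy dx`. -/
def skew1 (M N : ℕ) (t : ℂ) (f g : Polynomial ℂ) : ℂ :=
  ∫ x in Ioi (0 : ℝ), ∫ y in Ioi (0 : ℝ),
    ((Real.sign (x - y) : ℝ) : ℂ) / 2 * f.eval (x : ℂ) * g.eval (y : ℂ) *
      wC M N t x * wC M N t y

/-- The inner product `⟨f,g⟩₂ = ∫₀^∞ f(x)·g(x)·w₀(x) dx`. -/
def inner2C (M N : ℕ) (f g : Polynomial ℂ) : ℂ :=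
  ∫ x in Ioi (0 : ℝ), f.eval (x : ℂ) * g.eval (x : ℂ) * (w0R M N x : ℂ)

/-- `IsLag M N L` says that `L n` is the monic degree-`n` orthogonal polynomial for the
weight `w₀` (the rescaled Laguerre polynomial). -/
def IsLag (M N : ℕ) (L : ℕ → Polynomial ℂ) : Prop :=
  ∀ n, (L n).Monic ∧ (L n).natDegree = n ∧
    ∀ j, j < n → inner2C M N (L n) (Polynomial.X ^ j) = 0

/-- The operator `T(q)(x) = x(t−x)q′(x) +
[(t−2x) − (M/2)x(t−x) + ((M−N−1)/2)(t−x) + x/2]·q(x)`,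
i.e. formally `T(q) = (d/dx)(q·x·(t−x)·w)/w`. -/
def Tq (M N : ℕ) (t : ℂ) (q : Polynomial ℂ) : Polynomial ℂ :=
  Polynomial.X * (Polynomial.C t - Polynomial.X) * Polynomial.derivative q +
    ((Polynomial.C t - 2 * Polynomial.X)
        - Polynomial.C ((M : ℂ) / 2) * (Polynomial.X * (Polynomial.C t - Polynomial.X))
        + Polynomial.C (((M : ℂ) - N - 1) / 2) * (Polynomial.C t - Polynomial.X)
        + Polynomial.C (1 / 2) * Polynomial.X) * q

/-- `ε(f)(x) = ∫₀^∞ (1/2)·sgn(x−y)·f(y) dy`. -/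
def epsC (f : ℝ → ℂ) (x : ℝ) : ℂ :=
  ∫ y in Ioi (0 : ℝ), ((Real.sign (x - y) : ℝ) : ℂ) / 2 * f y

/-- The squared norm `h_{n,0} = ∫₀^∞ L_n(x)²·w₀(x) dx`. -/
def hC (M N : ℕ) (L : ℕ → Polynomial ℂ) (n : ℕ) : ℂ :=
  ∫ x in Ioi (0 : ℝ), (L n).eval (x : ℂ) ^ 2 * (w0R M N x : ℂ)

end

lemma measurable_realSign : Measurable Real.sign := by
  unfold Real.sign
  exact Measurable.ite measurableSet_Iio measurable_const
    (Measurable.ite measurableSet_Ioi measurable_const measurable_const)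

lemma norm_sign_div_two_le (r : ℝ) : ‖((Real.sign r : ℝ) : ℂ) / 2‖ ≤ 1 := by
  rcases Real.sign_apply_eq r with h | h | h <;> rw [h] <;> norm_num

lemma integrable_sign_kernel {μ : Measure ℝ} [SFinite μ] {f g : ℝ → ℂ}
    (hf : Integrable f μ) (hg : Integrable g μ) :
    Integrable (fun p : ℝ × ℝ => ((Real.sign (p.1 - p.2) : ℝ) : ℂ) / 2 * (f p.1 * g p.2))
      (μ.prod μ) := by
  refine (hf.mul_prod hg).bdd_mul (c := 1) ?_ ?_
  · exact ((Complex.measurable_ofReal.comp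
      (measurable_realSign.comp (measurable_fst.sub measurable_snd))).div_const 2).aestronglyMeasurable
  · exact Filter.Eventually.of_forall fun p => norm_sign_div_two_le _

lemma mul_epsC_eq (f g : ℝ → ℂ) (x : ℝ) :
    f x * epsC g x =
      ∫ y in Ioi (0 : ℝ), ((Real.sign (x - y) : ℝ) : ℂ) / 2 * (f x * g y) := by
  rw [epsC, ← integral_const_mul]
  exact integral_congr_ae (Filter.Eventually.of_forall fun y => by ring)

lemma integrableOn_mul_epsC {f g : ℝ → ℂ} (hf : IntegrableOn f (Ioi 0))
    (hg : IntegrableOn g (Ioi 0)) : IntegrableOn (fun x => f x * epsC g x) (Ioi 0) := by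
  simp_rw [mul_epsC_eq]
  exact (integrable_sign_kernel hf hg).integral_prod_left

lemma integral_mul_epsC_eq_prod {f g : ℝ → ℂ} (hf : IntegrableOn f (Ioi 0))
    (hg : IntegrableOn g (Ioi 0)) :
    ∫ x in Ioi (0 : ℝ), f x * epsC g x =
      ∫ p, ((Real.sign (p.1 - p.2) : ℝ) : ℂ) / 2 * (f p.1 * g p.2)
        ∂((volume.restrict (Ioi (0 : ℝ))).prod (volume.restrict (Ioi (0 : ℝ)))) := by
  simp_rw [mul_epsC_eq]
  exact (integral_prod _ (integrable_sign_kernel hf hg)).symm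

/-- The bilinear pairing `∫ f · ε(g)` is antisymmetric. -/
lemma integral_mul_epsC_comm {f g : ℝ → ℂ} (hf : IntegrableOn f (Ioi 0))
    (hg : IntegrableOn g (Ioi 0)) :
    ∫ x in Ioi (0 : ℝ), f x * epsC g x = -∫ x in Ioi (0 : ℝ), g x * epsC f x := by
  rw [integral_mul_epsC_eq_prod hf hg, integral_mul_epsC_eq_prod hg hf, ← integral_prod_swap,
    ← integral_neg]
  refine integral_congr_ae (Filter.Eventually.of_forall fun p => ?_)
  simp only [Prod.fst_swap, Prod.snd_swap]
  rw [← neg_sub p.1 p.2, Real.sign_neg]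
  push_cast
  ring

/-- The Jacobi formula for the derivative of a determinant. -/
lemma hasDerivAt_det {n : Type*} [Fintype n] [DecidableEq n] {A : ℂ → Matrix n n ℂ}
    {A' : Matrix n n ℂ} {t : ℂ} (hA : ∀ i j, HasDerivAt (fun s => A s i j) (A' i j) t) :
    HasDerivAt (fun s => (A s).det) (∑ i, ∑ j, (A t).adjugate i j * A' j i) t := by
  let F : ContinuousMultilinearMap ℂ (fun _ : n => n → ℂ) ℂ :=
    { (Matrix.detRowAlternating (R := ℂ) (n := n)).toMultilinearMap with
      cont := by
        change Continuous fun B : n → n → ℂ => Matrix.det (Matrix.of B)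
        exact Continuous.matrix_det continuous_id }
  have hA₁ : HasDerivAt (fun s i => A s i) (fun i => A' i) t :=
    hasDerivAt_pi.2 fun i => hasDerivAt_pi.2 fun j => hA i j
  have key := (F.hasFDerivAt (x := fun i => A t i)).comp_hasDerivAt t hA₁
  refine key.congr_deriv ?_
  rw [ContinuousMultilinearMap.linearDeriv_apply, Finset.sum_comm]
  refine Finset.sum_congr rfl fun i _ => ?_
  change ((A t).updateRow i (A' i)).det = _
  rw [← Matrix.cramer_transpose_apply, Matrix.cramer_eq_adjugate_mulVec,
    ← Matrix.adjugate_transpose]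
  rfl

/-- The Gram determinant of a bilinear form is the same for all families of monic polynomials. -/
lemma det_gram_eq_of_monic (B : ℂ[X] →ₗ[ℂ] ℂ[X] →ₗ[ℂ] ℂ) (N : ℕ) (P : ℕ → ℂ[X])
    (hP : ∀ j < N, (P j).Monic ∧ (P j).natDegree = j) :
    (Matrix.of fun j k : Fin N => B (P j) (P k)).det =
      (Matrix.of fun j k : Fin N => B (X ^ (j : ℕ)) (X ^ (k : ℕ))).det := by
  set A : Matrix (Fin N) (Fin N) ℂ := Matrix.of fun j i => (P j).coeff i
  have hA : A.det = 1 := by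
    rw [Matrix.det_of_isLowerTriangular A]
    · refine Finset.prod_eq_one fun i _ => ?_
      have h := hP i i.2
      simpa [A, Polynomial.Monic, Polynomial.leadingCoeff, h.2] using h.1
    · intro i j hij
      refine Polynomial.coeff_eq_zero_of_natDegree_lt ?_
      rw [(hP i i.2).2]
      exact hij
  have hsum : ∀ j : Fin N, P j = ∑ i : Fin N, A j i • (X : ℂ[X]) ^ (i : ℕ) := fun j => by
    conv_lhs => rw [(P j).as_sum_range' N (by rw [(hP j j.2).2]; exact j.2)]
    rw [Finset.sum_range]
    exact Finset.sum_congr rfl fun i _ => by simp [A, Polynomial.smul_X_eq_monomial]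
  have : (Matrix.of fun j k : Fin N => B (P j) (P k)) =
      A * (Matrix.of fun j k : Fin N => B (X ^ (j : ℕ)) (X ^ (k : ℕ))) * A.transpose := by
    ext j k
    simp only [Matrix.of_apply, Matrix.mul_apply, Matrix.transpose_apply]
    rw [hsum j, hsum k]
    simp only [map_sum, map_smul, LinearMap.sum_apply, LinearMap.smul_apply, smul_eq_mul,
      Finset.mul_sum, Finset.sum_mul]
    exact Finset.sum_congr rfl fun x _ => Finset.sum_congr rfl fun y _ => by ring
  rw [this, Matrix.det_mul, Matrix.det_mul, Matrix.det_transpose, hA, one_mul, mul_one]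

lemma sub_ofReal_mem_slitPlane {t : ℂ} (ht : 0 < t.im) (x : ℝ) :
    t - (x : ℂ) ∈ Complex.slitPlane :=
  Or.inr (by simpa using ht.ne')

lemma sub_ofReal_ne_zero {t : ℂ} (ht : 0 < t.im) (x : ℝ) : t - (x : ℂ) ≠ 0 :=
  Complex.slitPlane_ne_zero (sub_ofReal_mem_slitPlane ht x)

lemma le_norm_sub_ofReal {t : ℂ} {δ : ℝ} (ht : δ ≤ t.im) (x : ℝ) : δ ≤ ‖t - (x : ℂ)‖ :=
  ht.trans <| by simpa using (le_abs_self _).trans (Complex.abs_im_le_norm (t - (x : ℂ)))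

lemma norm_sub_ofReal_cpow_le {t : ℂ} {δ : ℝ} (hδ : 0 < δ) (ht : δ ≤ t.im) (x : ℝ) :
    ‖(t - (x : ℂ)) ^ (-(1 / 2) : ℂ)‖ ≤ δ ^ (-(1 / 2) : ℝ) := by
  have h : (-(1 / 2) : ℂ) = ((-(1 / 2) : ℝ) : ℂ) := by push_cast; rfl
  rw [h, Complex.norm_cpow_real]
  exact Real.rpow_le_rpow_of_nonpos hδ (le_norm_sub_ofReal ht x) (by norm_num)

lemma norm_inv_sub_ofReal_le {t : ℂ} {δ : ℝ} (hδ : 0 < δ) (ht : δ ≤ t.im) (x : ℝ) :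
    ‖(t - (x : ℂ))⁻¹‖ ≤ δ⁻¹ := by
  rw [norm_inv]
  exact inv_anti₀ hδ (le_norm_sub_ofReal ht x)

/-- The factor of the weight that does not depend on `t`. -/
noncomputable def baseWeight (M N : ℕ) (x : ℝ) : ℂ :=
  Complex.exp (-(M : ℂ) * x / 2) * (x : ℂ) ^ (((((M : ℝ) - N - 1) / 2 : ℝ)) : ℂ)

lemma wC_eq (M N : ℕ) (t : ℂ) (x : ℝ) :
    wC M N t x = baseWeight M N x * (t - x) ^ (-(1 / 2) : ℂ) := rfl

lemma exponent_nonneg {M N : ℕ} (hNM : N < M) : 0 ≤ ((M : ℝ) - N - 1) / 2 := by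
  have : (N : ℝ) + 1 ≤ M := by exact_mod_cast hNM
  linarith

lemma integrableOn_eval_mul_rpow_mul_exp {s b : ℝ} (hs : 0 ≤ s) (hb : 0 < b) (f : ℂ[X]) :
    IntegrableOn (fun x : ℝ => f.eval (x : ℂ) * ((x ^ s * Real.exp (-b * x) : ℝ) : ℂ))
      (Ioi 0) := by
  induction f using Polynomial.induction_on' with
  | add p q hp hq =>
    simp_rw [Polynomial.eval_add, add_mul]
    exact hp.add hq
  | monomial n c =>
    have h := ((integrableOn_rpow_mul_exp_neg_mul_rpow (p := 1) (s := s + n) (b := b)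
      (by linarith [n.cast_nonneg (α := ℝ)]) one_pos hb).ofReal (𝕜 := ℂ)).const_mul c
    refine IntegrableOn.congr_fun h (fun x hx => ?_) measurableSet_Ioi
    simp only [Real.rpow_one, Polynomial.eval_monomial]
    rw [Real.rpow_add hx, Real.rpow_natCast]
    change c * ((x ^ s * x ^ n * Real.exp (-b * x) : ℝ) : ℂ) = _
    push_cast
    ring

lemma integrableOn_eval_mul_baseWeight {M N : ℕ} (hNM : N < M) (f : ℂ[X]) :
    IntegrableOn (fun x : ℝ => f.eval (x : ℂ) * baseWeight M N x) (Ioi 0) := by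
  have hM : (0 : ℝ) < M := by exact_mod_cast (Nat.zero_le N).trans_lt hNM
  refine (integrableOn_eval_mul_rpow_mul_exp (exponent_nonneg hNM) (half_pos hM) f).congr_fun
    (fun x hx => ?_) measurableSet_Ioi
  have hx : (0 : ℝ) < x := hx
  simp only [baseWeight]
  rw [← Complex.ofReal_cpow hx.le]
  push_cast
  rw [show -((M : ℂ) / 2) * x = -(M : ℂ) * x / 2 by ring]
  ring

lemma integrableOn_eval_mul_w0R {M N : ℕ} (hNM : N < M) (f : ℂ[X]) :
    IntegrableOn (fun x : ℝ => f.eval (x : ℂ) * (w0R M N x : ℂ)) (Ioi 0) := by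
  have hM : (0 : ℝ) < M := by exact_mod_cast (Nat.zero_le N).trans_lt hNM
  simpa only [Real.rpow_natCast, w0R] using
    integrableOn_eval_mul_rpow_mul_exp (M - N).cast_nonneg hM f

lemma continuous_sub_ofReal_cpow {t : ℂ} (ht : 0 < t.im) (c : ℂ) :
    Continuous fun x : ℝ => (t - (x : ℂ)) ^ c :=
  (continuous_const.sub Complex.continuous_ofReal).cpow continuous_const
    fun x => sub_ofReal_mem_slitPlane ht x

lemma continuous_inv_sub_ofReal {t : ℂ} (ht : 0 < t.im) :
    Continuous fun x : ℝ => (t - (x : ℂ))⁻¹ :=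
  (continuous_const.sub Complex.continuous_ofReal).inv₀ fun x => sub_ofReal_ne_zero ht x

lemma integrableOn_eval_mul_wC {M N : ℕ} (hNM : N < M) {t : ℂ} (ht : 0 < t.im) (f : ℂ[X]) :
    IntegrableOn (fun x : ℝ => f.eval (x : ℂ) * wC M N t x) (Ioi 0) := by
  simp_rw [wC_eq, ← mul_assoc]
  exact Integrable.mul_bdd (c := t.im ^ (-(1 / 2) : ℝ)) (integrableOn_eval_mul_baseWeight hNM f)
    (continuous_sub_ofReal_cpow ht _).aestronglyMeasurable
    (Filter.Eventually.of_forall fun x => norm_sub_ofReal_cpow_le ht le_rfl x)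

lemma integrableOn_eval_mul_wC_div {M N : ℕ} (hNM : N < M) {t : ℂ} (ht : 0 < t.im) (f : ℂ[X]) :
    IntegrableOn (fun x : ℝ => f.eval (x : ℂ) * wC M N t x / (t - x)) (Ioi 0) := by
  simp_rw [div_eq_mul_inv]
  exact Integrable.mul_bdd (c := t.im⁻¹) (integrableOn_eval_mul_wC hNM ht f)
    (continuous_inv_sub_ofReal ht).aestronglyMeasurable
    (Filter.Eventually.of_forall fun x => norm_inv_sub_ofReal_le ht le_rfl x)

lemma skew1_eq_integral_mul_epsC (M N : ℕ) (t : ℂ) (f g : ℂ[X]) :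
    skew1 M N t f g = ∫ x in Ioi (0 : ℝ), f.eval (x : ℂ) * wC M N t x *
      epsC (fun y => g.eval (y : ℂ) * wC M N t y) x := by
  refine integral_congr_ae (Filter.Eventually.of_forall fun x => ?_)
  dsimp only
  rw [mul_epsC_eq (fun x : ℝ => f.eval (x : ℂ) * wC M N t x)]
  exact integral_congr_ae (Filter.Eventually.of_forall fun y => by ring)

lemma skew1_antisymm {M N : ℕ} (hNM : N < M) {t : ℂ} (ht : 0 < t.im) (f g : ℂ[X]) :
    skew1 M N t f g = -skew1 M N t g f := by
  rw [skew1_eq_integral_mul_epsC, skew1_eq_integral_mul_epsC]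
  exact integral_mul_epsC_comm (integrableOn_eval_mul_wC hNM ht f)
    (integrableOn_eval_mul_wC hNM ht g)

lemma skew1_add_left {M N : ℕ} (hNM : N < M) {t : ℂ} (ht : 0 < t.im) (f₁ f₂ g : ℂ[X]) :
    skew1 M N t (f₁ + f₂) g = skew1 M N t f₁ g + skew1 M N t f₂ g := by
  have hg := integrableOn_eval_mul_wC hNM ht g
  simp_rw [skew1_eq_integral_mul_epsC]
  rw [← integral_add (integrableOn_mul_epsC (integrableOn_eval_mul_wC hNM ht f₁) hg)
    (integrableOn_mul_epsC (integrableOn_eval_mul_wC hNM ht f₂) hg)]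
  refine integral_congr_ae (Filter.Eventually.of_forall fun x => ?_)
  simp only [Polynomial.eval_add]
  ring

lemma skew1_smul_left (M N : ℕ) (t c : ℂ) (f g : ℂ[X]) :
    skew1 M N t (c • f) g = c • skew1 M N t f g := by
  simp_rw [skew1_eq_integral_mul_epsC, smul_eq_mul]
  rw [← integral_const_mul]
  refine integral_congr_ae (Filter.Eventually.of_forall fun x => ?_)
  simp only [Polynomial.eval_smul, smul_eq_mul]
  ring

/-- The skew product as a bilinear map. -/
noncomputable def skewBilin {M N : ℕ} (hNM : N < M) {t : ℂ} (ht : 0 < t.im) :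
    ℂ[X] →ₗ[ℂ] ℂ[X] →ₗ[ℂ] ℂ :=
  LinearMap.mk₂ ℂ (skew1 M N t) (skew1_add_left hNM ht) (fun c f g => skew1_smul_left M N t c f g)
    (fun f g₁ g₂ => by
      rw [skew1_antisymm hNM ht, skew1_add_left hNM ht, neg_add, ← skew1_antisymm hNM ht,
        ← skew1_antisymm hNM ht])
    (fun c f g => by
      rw [skew1_antisymm hNM ht, skew1_smul_left, ← smul_neg, ← skew1_antisymm hNM ht])

lemma skewBilin_apply {M N : ℕ} (hNM : N < M) {t : ℂ} (ht : 0 < t.im) (f g : ℂ[X]) :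
    skewBilin hNM ht f g = skew1 M N t f g := rfl

lemma hasDerivAt_wC (M N : ℕ) {t : ℂ} (ht : 0 < t.im) (x : ℝ) :
    HasDerivAt (fun s => wC M N s x) (-(1 / 2) * (wC M N t x / (t - x))) t := by
  have h := ((((hasDerivAt_id t).sub_const (x : ℂ)).cpow_const (c := -(1 / 2))
    (sub_ofReal_mem_slitPlane ht x)).const_mul (baseWeight M N x))
  refine h.congr_deriv ?_
  simp only [id]
  rw [Complex.cpow_sub _ _ (sub_ofReal_ne_zero ht x), Complex.cpow_one, wC_eq]
  ring

lemma hasDerivAt_skewKernel (M N : ℕ) {s : ℂ} (hs : 0 < s.im) (f g : ℂ[X]) (x y : ℝ) :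
    HasDerivAt (fun s => ((Real.sign (x - y) : ℝ) : ℂ) / 2 *
      (f.eval (x : ℂ) * wC M N s x * (g.eval (y : ℂ) * wC M N s y)))
      (-(1 / 2) * (((Real.sign (x - y) : ℝ) : ℂ) / 2 *
        (f.eval (x : ℂ) * wC M N s x / (s - x) * (g.eval (y : ℂ) * wC M N s y)) +
        ((Real.sign (x - y) : ℝ) : ℂ) / 2 *
        (f.eval (x : ℂ) * wC M N s x * (g.eval (y : ℂ) * wC M N s y / (s - y))))) s := by
  have h := (((hasDerivAt_wC M N hs x).const_mul (f.eval (x : ℂ))).mul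
    ((hasDerivAt_wC M N hs y).const_mul (g.eval (y : ℂ)))).const_mul
    (((Real.sign (x - y) : ℝ) : ℂ) / 2)
  refine h.congr_deriv ?_
  ring

lemma norm_deriv_skewKernel_le (M N : ℕ) {δ : ℝ} (hδ : 0 < δ) {s : ℂ} (hs : δ ≤ s.im)
    (f g : ℂ[X]) (x y : ℝ) :
    ‖-(1 / 2) * (((Real.sign (x - y) : ℝ) : ℂ) / 2 *
        (f.eval (x : ℂ) * wC M N s x / (s - x) * (g.eval (y : ℂ) * wC M N s y)) +
        ((Real.sign (x - y) : ℝ) : ℂ) / 2 *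
        (f.eval (x : ℂ) * wC M N s x * (g.eval (y : ℂ) * wC M N s y / (s - y))))‖ ≤
      δ⁻¹ * (δ ^ (-(1 / 2) : ℝ) * δ ^ (-(1 / 2) : ℝ)) *
        ‖f.eval (x : ℂ) * baseWeight M N x * (g.eval (y : ℂ) * baseWeight M N y)‖ := by
  have h₁ : ‖(-(1 / 2) : ℂ) * ((s - x)⁻¹ + (s - y)⁻¹)‖ ≤ δ⁻¹ := by
    have h := norm_add_le (s - (x : ℂ))⁻¹ (s - (y : ℂ))⁻¹
    have hx := norm_inv_sub_ofReal_le hδ hs x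
    have hy := norm_inv_sub_ofReal_le hδ hs y
    rw [norm_mul, show ‖(-(1 / 2) : ℂ)‖ = 1 / 2 by norm_num]
    linarith
  have h₂ := norm_sub_ofReal_cpow_le hδ hs x
  have h₃ := norm_sub_ofReal_cpow_le hδ hs y
  rw [wC_eq, wC_eq]
  generalize (s - (x : ℂ)) ^ (-(1 / 2) : ℂ) = p at *
  generalize (s - (y : ℂ)) ^ (-(1 / 2) : ℂ) = q at *
  generalize δ ^ (-(1 / 2) : ℝ) = d at *
  have e : -(1 / 2) * (((Real.sign (x - y) : ℝ) : ℂ) / 2 *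
        (f.eval (x : ℂ) * (baseWeight M N x * p) / (s - x) *
          (g.eval (y : ℂ) * (baseWeight M N y * q))) +
        ((Real.sign (x - y) : ℝ) : ℂ) / 2 *
        (f.eval (x : ℂ) * (baseWeight M N x * p) *
          (g.eval (y : ℂ) * (baseWeight M N y * q) / (s - y)))) =
      ((Real.sign (x - y) : ℝ) : ℂ) / 2 * ((-(1 / 2) * ((s - x)⁻¹ + (s - y)⁻¹)) * (p * q) *
        (f.eval (x : ℂ) * baseWeight M N x * (g.eval (y : ℂ) * baseWeight M N y))) := by
    ring
  rw [e, norm_mul]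
  refine (mul_le_of_le_one_left (norm_nonneg _) (norm_sign_div_two_le _)).trans ?_
  rw [norm_mul]
  refine mul_le_mul_of_nonneg_right ?_ (norm_nonneg _)
  rw [norm_mul, norm_mul p]
  exact mul_le_mul h₁ (mul_le_mul h₂ h₃ (norm_nonneg _) ((norm_nonneg _).trans h₂))
    (by positivity) (inv_nonneg.2 hδ.le)

/-- The `t`-derivative of the skew product. -/
lemma hasDerivAt_skew1 {M N : ℕ} (hNM : N < M) {t : ℂ} (ht : 0 < t.im) (f g : ℂ[X]) :
    HasDerivAt (fun s => skew1 M N s f g)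
      (-(1 / 2) * ((∫ x in Ioi (0 : ℝ), f.eval (x : ℂ) * wC M N t x / (t - x) *
          epsC (fun y => g.eval (y : ℂ) * wC M N t y) x) -
        ∫ x in Ioi (0 : ℝ), g.eval (x : ℂ) * wC M N t x / (t - x) *
          epsC (fun y => f.eval (y : ℂ) * wC M N t y) x)) t := by
  obtain ⟨δ, hδ, hδt⟩ : ∃ δ : ℝ, 0 < δ ∧ δ < t.im := exists_between ht
  have hfw : ∀ s : ℂ, 0 < s.im → _ := fun s hs => integrableOn_eval_mul_wC hNM hs f
  have hgw : ∀ s : ℂ, 0 < s.im → _ := fun s hs => integrableOn_eval_mul_wC hNM hs g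
  have hfd := integrableOn_eval_mul_wC_div hNM ht f
  have hgd := integrableOn_eval_mul_wC_div hNM ht g
  have hopen : {s : ℂ | δ < s.im} ∈ nhds t :=
    (isOpen_lt continuous_const Complex.continuous_im).mem_nhds hδt
  have hmem : ∀ s ∈ {s : ℂ | δ < s.im}, δ < s.im := fun _ hs => hs
  have hbase := (Integrable.norm (Integrable.mul_prod (integrableOn_eval_mul_baseWeight hNM f)
    (integrableOn_eval_mul_baseWeight hNM g))).const_mul
    (δ⁻¹ * (δ ^ (-(1 / 2) : ℝ) * δ ^ (-(1 / 2) : ℝ)))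
  have hF := fun (s : ℂ) (hs : 0 < s.im) => integrable_sign_kernel (hfw s hs) (hgw s hs)
  have hF₁ := integrable_sign_kernel hfd (hgw t ht)
  have hF₂ := integrable_sign_kernel (hfw t ht) hgd
  have hF' := (hF₁.add hF₂).const_mul (-(1 / 2))
  have hbound := fun (p : ℝ × ℝ) (s : ℂ) (hs : s ∈ {s : ℂ | δ < s.im}) =>
    norm_deriv_skewKernel_le M N hδ (hmem s hs).le f g p.1 p.2
  have hder := fun (p : ℝ × ℝ) (s : ℂ) (hs : s ∈ {s : ℂ | δ < s.im}) =>
    hasDerivAt_skewKernel M N (hδ.trans (hmem s hs)) f g p.1 p.2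
  have main := (hasDerivAt_integral_of_dominated_loc_of_deriv_le
    (F := fun s (p : ℝ × ℝ) => ((Real.sign (p.1 - p.2) : ℝ) : ℂ) / 2 *
      (f.eval (p.1 : ℂ) * wC M N s p.1 * (g.eval (p.2 : ℂ) * wC M N s p.2))) hopen
    (Filter.eventually_of_mem hopen fun s hs =>
      (hF s (hδ.trans (hmem s hs))).aestronglyMeasurable)
    (hF t ht) hF'.aestronglyMeasurable (Filter.Eventually.of_forall hbound) hbase
    (Filter.Eventually.of_forall hder)).2
  refine (main.congr_of_eventuallyEq (Filter.eventually_of_mem hopen fun s hs => ?_)).congr_deriv ?_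
  · have hs := hδ.trans (hmem s hs)
    exact (skew1_eq_integral_mul_epsC M N s f g).trans
      (integral_mul_epsC_eq_prod (hfw s hs) (hgw s hs))
  · have h := integral_add hF₁ hF₂
    rw [← integral_mul_epsC_eq_prod hfd (hgw t ht), ← integral_mul_epsC_eq_prod (hfw t ht) hgd,
      ← neg_eq_iff_eq_neg.2 (integral_mul_epsC_comm hgd (hfw t ht)), ← sub_eq_add_neg] at h
    exact (integral_const_mul _ _).trans (congrArg _ h)

/-- A primitive of `T(q)·w`, which for `x > 0` equals `q(x)·x·(t−x)·w(x)`. -/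
noncomputable def primitiveTq (M N : ℕ) (t : ℂ) (q : ℂ[X]) (x : ℝ) : ℂ :=
  q.eval (x : ℂ) * Complex.exp (-(M : ℂ) * x / 2) *
    (x : ℂ) ^ ((((((M : ℝ) - N - 1) / 2 : ℝ)) : ℂ) + 1) * (t - x) ^ (1 / 2 : ℂ)

lemma sub_ofReal_cpow_half {t : ℂ} (ht : 0 < t.im) (x : ℝ) :
    (t - (x : ℂ)) ^ (1 / 2 : ℂ) = (t - x) * (t - x) ^ (-(1 / 2) : ℂ) := by
  have h0 := sub_ofReal_ne_zero ht x
  conv_rhs => enter [1]; rw [← Complex.cpow_one (t - (x : ℂ))]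
  rw [← Complex.cpow_add _ _ h0]
  norm_num

lemma exponent_add_one_ne_zero {M N : ℕ} (hNM : N < M) :
    (((((M : ℝ) - N - 1) / 2 : ℝ)) : ℂ) + 1 ≠ 0 := by
  have h := exponent_nonneg hNM
  exact_mod_cast (by linarith : (0 : ℝ) < ((M : ℝ) - N - 1) / 2 + 1).ne'

lemma primitiveTq_eq {M N : ℕ} {t : ℂ} (ht : 0 < t.im) (q : ℂ[X]) {x : ℝ} (hx : 0 < x) :
    primitiveTq M N t q x = (q * (X * (C t - X))).eval (x : ℂ) * wC M N t x := by
  have hx' : (x : ℂ) ≠ 0 := by exact_mod_cast hx.ne'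
  simp only [primitiveTq, sub_ofReal_cpow_half ht, Complex.cpow_add _ _ hx', Complex.cpow_one, wC,
    Polynomial.eval_mul, Polynomial.eval_sub, Polynomial.eval_X, Polynomial.eval_C]
  ring

lemma hasDerivAt_primitiveTq {M N : ℕ} (hNM : N < M) {t : ℂ} (ht : 0 < t.im) (q : ℂ[X]) {x : ℝ}
    (hx : 0 < x) :
    HasDerivAt (primitiveTq M N t q) ((Tq M N t q).eval (x : ℂ) * wC M N t x) x := by
  have hx' : (x : ℂ) ≠ 0 := by exact_mod_cast hx.ne'
  have h₁ := (q.hasDerivAt (x : ℂ)).comp_ofReal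
  have h₂ := ((((hasDerivAt_id (x : ℂ)).const_mul (-(M : ℂ))).div_const 2).cexp).comp_ofReal
  have h₃ := hasDerivAt_ofReal_cpow_const hx.ne' (exponent_add_one_ne_zero hNM)
  have h₄ := (((hasDerivAt_id (x : ℂ)).const_sub t).cpow_const (c := 1 / 2)
    (sub_ofReal_mem_slitPlane ht x)).comp_ofReal
  refine (((h₁.mul h₂).mul h₃).mul h₄).congr_deriv ?_
  simp only [Pi.mul_apply, id, sub_ofReal_cpow_half ht, Complex.cpow_add _ _ hx', Complex.cpow_one,
    add_sub_cancel_right, wC, Tq, show (1 / 2 - 1 : ℂ) = -(1 / 2) by norm_num,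
    Polynomial.eval_mul, Polynomial.eval_sub, Polynomial.eval_add, Polynomial.eval_X,
    Polynomial.eval_C, Polynomial.eval_ofNat]
  push_cast
  ring

lemma continuous_primitiveTq {M N : ℕ} (hNM : N < M) {t : ℂ} (ht : 0 < t.im) (q : ℂ[X]) :
    Continuous (primitiveTq M N t q) := by
  refine ((Continuous.mul ?_ ?_).mul (Complex.continuous_ofReal_cpow_const ?_)).mul
    (continuous_sub_ofReal_cpow ht _)
  · exact q.continuous.comp Complex.continuous_ofReal
  · fun_prop
  · have h := exponent_nonneg hNM
    simp only [Complex.add_re, Complex.ofReal_re, Complex.one_re]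
    linarith

/-- Integration by parts: `ε(T(q)·w) = q·x·(t−x)·w`. -/
lemma epsC_Tq {M N : ℕ} (hNM : N < M) {t : ℂ} (ht : 0 < t.im) (q : ℂ[X]) {x : ℝ} (hx : 0 < x) :
    epsC (fun y => (Tq M N t q).eval (y : ℂ) * wC M N t y) x =
      (q * (X * (C t - X))).eval (x : ℂ) * wC M N t x := by
  set g : ℝ → ℂ := fun y => (Tq M N t q).eval (y : ℂ) * wC M N t y
  have hint : IntegrableOn g (Ioi 0) := integrableOn_eval_mul_wC hNM ht _
  have hcont := continuous_primitiveTq hNM ht q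
  have hderiv : ∀ y ∈ Ioi (0 : ℝ), HasDerivAt (primitiveTq M N t q) (g y) y :=
    fun y hy => hasDerivAt_primitiveTq hNM ht q hy
  have hGint : IntegrableOn (primitiveTq M N t q) (Ioi 0) :=
    (integrableOn_eval_mul_wC hNM ht (q * (X * (C t - X)))).congr_fun
      (fun y hy => (primitiveTq_eq ht q hy).symm) measurableSet_Ioi
  have hlim := tendsto_zero_of_hasDerivAt_of_integrableOn_Ioi hderiv hint hGint
  have h0 : ∫ y in Ioi (0 : ℝ), g y = 0 := by
    rw [integral_Ioi_of_hasDerivAt_of_tendsto hcont.continuousWithinAt hderiv hint hlim]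
    rw [primitiveTq, Complex.ofReal_zero, Complex.zero_cpow (exponent_add_one_ne_zero hNM)]
    ring
  have hsub : Ioi x ⊆ Ioi (0 : ℝ) := Ioi_subset_Ioi hx.le
  have hx1 : ∫ y in Ioi x, g y = -primitiveTq M N t q x := by
    rw [integral_Ioi_of_hasDerivAt_of_tendsto hcont.continuousWithinAt
      (fun y hy => hderiv y (hsub hy)) (hint.mono_set hsub) hlim, zero_sub]
  have hsplit := setIntegral_union (μ := volume) (f := g) (s := Ioc 0 x) (t := Ioi x)
    (Ioc_disjoint_Ioi le_rfl) measurableSet_Ioi (hint.mono_set Ioc_subset_Ioi_self)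
    (hint.mono_set hsub)
  rw [Ioc_union_Ioi_eq_Ioi hx.le, h0, hx1] at hsplit
  have hx0 : ∫ y in Ioc 0 x, g y = primitiveTq M N t q x := by linear_combination -hsplit
  have hk : IntegrableOn (fun y => ((Real.sign (x - y) : ℝ) : ℂ) / 2 * g y) (Ioi 0) :=
    Integrable.bdd_mul (c := 1) hint ((Complex.measurable_ofReal.comp
      (measurable_realSign.comp (measurable_const.sub measurable_id))).div_const 2).aestronglyMeasurable
      (Filter.Eventually.of_forall fun y => norm_sign_div_two_le _)
  have hlow : ∫ y in Ioc 0 x, ((Real.sign (x - y) : ℝ) : ℂ) / 2 * g y =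
      ∫ y in Ioc 0 x, 1 / 2 * g y := by
    rw [integral_Ioc_eq_integral_Ioo, integral_Ioc_eq_integral_Ioo]
    refine setIntegral_congr_fun measurableSet_Ioo fun y hy => ?_
    simp only [Real.sign_of_pos (sub_pos.2 hy.2), Complex.ofReal_one]
  have hhigh : ∫ y in Ioi x, ((Real.sign (x - y) : ℝ) : ℂ) / 2 * g y =
      ∫ y in Ioi x, -(1 / 2) * g y := by
    refine setIntegral_congr_fun measurableSet_Ioi fun y hy => ?_
    simp only [Real.sign_of_neg (sub_neg.2 hy), Complex.ofReal_neg, Complex.ofReal_one]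
    ring
  rw [epsC, ← Ioc_union_Ioi_eq_Ioi hx.le, setIntegral_union (Ioc_disjoint_Ioi le_rfl)
    measurableSet_Ioi (hk.mono_set Ioc_subset_Ioi_self) (hk.mono_set hsub), hlow, hhigh,
    integral_const_mul, integral_const_mul, hx0, hx1, ← primitiveTq_eq ht q hx]
  ring

lemma wC_mul_self {M N : ℕ} (hNM : N < M) {t : ℂ} (ht : 0 < t.im) {x : ℝ} (hx : 0 < x) :
    wC M N t x * (x * (t - x) * wC M N t x) = (w0R M N x : ℂ) := by
  have h0 := sub_ofReal_ne_zero ht x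
  have hx' : (x : ℂ) ≠ 0 := by exact_mod_cast hx.ne'
  have hc : (t - (x : ℂ)) ^ (-(1 / 2) : ℂ) * (t - (x : ℂ)) ^ (-(1 / 2) : ℂ) * (t - x) = 1 := by
    rw [← Complex.cpow_add _ _ h0, show (-(1 / 2) + -(1 / 2) : ℂ) = -1 by norm_num,
      Complex.cpow_neg_one, inv_mul_cancel₀ h0]
  have he : Complex.exp (-(M : ℂ) * x / 2) * Complex.exp (-(M : ℂ) * x / 2) =
      Complex.exp (-(M : ℂ) * x) := by
    rw [← Complex.exp_add]
    congr 1
    ring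
  have hp : (x : ℂ) ^ (((((M : ℝ) - N - 1) / 2 : ℝ)) : ℂ) *
      (x : ℂ) ^ (((((M : ℝ) - N - 1) / 2 : ℝ)) : ℂ) * x = (x : ℂ) ^ (M - N) := by
    conv_lhs => enter [2]; rw [← Complex.cpow_one (x : ℂ)]
    rw [← Complex.cpow_add _ _ hx', ← Complex.cpow_add _ _ hx', ← Complex.cpow_natCast]
    congr 1
    push_cast [Nat.cast_sub hNM.le]
    ring
  have hw : (w0R M N x : ℂ) = (x : ℂ) ^ (M - N) * Complex.exp (-(M : ℂ) * x) := by
    simp [w0R]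
  rw [hw, ← hp, ← he, wC]
  linear_combination (Complex.exp (-(M : ℂ) * x / 2) * Complex.exp (-(M : ℂ) * x / 2) *
    ((x : ℂ) ^ (((((M : ℝ) - N - 1) / 2 : ℝ)) : ℂ) *
      (x : ℂ) ^ (((((M : ℝ) - N - 1) / 2 : ℝ)) : ℂ) * x)) * hc

lemma skew1_Tq {M N : ℕ} (hNM : N < M) {t : ℂ} (ht : 0 < t.im) (p q : ℂ[X]) :
    skew1 M N t p (Tq M N t q) = inner2C M N p q := by
  rw [skew1_eq_integral_mul_epsC]
  refine setIntegral_congr_fun measurableSet_Ioi fun x hx => ?_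
  simp only [epsC_Tq hNM ht q hx, ← wC_mul_self hNM ht hx, Polynomial.eval_mul,
    Polynomial.eval_sub, Polynomial.eval_X, Polynomial.eval_C]
  ring

lemma natDegree_Tq_le (M N : ℕ) (t : ℂ) (q : ℂ[X]) :
    (Tq M N t q).natDegree ≤ q.natDegree + 2 := by
  have h₂ : (X * (C t - X) : ℂ[X]).natDegree ≤ 2 := by compute_degree
  have h₁ : ((C t - 2 * X) - C ((M : ℂ) / 2) * (X * (C t - X))
      + C (((M : ℂ) - N - 1) / 2) * (C t - X) + C (1 / 2) * X : ℂ[X]).natDegree ≤ 2 := by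
    compute_degree
  refine natDegree_add_le_of_degree_le ?_ ?_
  · refine natDegree_mul_le.trans ?_
    have := natDegree_derivative_le q
    omega
  · refine natDegree_mul_le.trans ?_
    omega

lemma inner2C_comm (M N : ℕ) (p q : ℂ[X]) : inner2C M N p q = inner2C M N q p := by
  simp only [inner2C, mul_comm (p.eval _)]

/-- Positive definiteness of the inner product with weight `w₀`. -/
lemma eq_zero_of_inner2C_map_conj_eq_zero {M N : ℕ} (hNM : N < M) {p : ℂ[X]}
    (h : inner2C M N p (p.map (starRingEnd ℂ)) = 0) : p = 0 := by
  have hval : ∀ x : ℝ, p.eval (x : ℂ) * (p.map (starRingEnd ℂ)).eval (x : ℂ) * (w0R M N x : ℂ) =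
      ((‖p.eval (x : ℂ)‖ ^ 2 * w0R M N x : ℝ) : ℂ) := fun x => by
    have : (p.map (starRingEnd ℂ)).eval (x : ℂ) = (starRingEnd ℂ) (p.eval (x : ℂ)) := by
      rw [← Polynomial.eval_map_apply, Complex.conj_ofReal]
    rw [this, Complex.mul_conj, Complex.normSq_eq_norm_sq]
    push_cast
    rfl
  have hint : IntegrableOn (fun x : ℝ => ‖p.eval (x : ℂ)‖ ^ 2 * w0R M N x) (Ioi 0) := by
    have h := (integrableOn_eval_mul_w0R hNM (p * p.map (starRingEnd ℂ))).re
    refine IntegrableOn.congr_fun h (fun x _ => ?_) measurableSet_Ioi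
    simp only [Polynomial.eval_mul, hval]
    exact Complex.ofReal_re _
  have hw : ∀ x ∈ Ioi (0 : ℝ), 0 < w0R M N x := fun x hx =>
    mul_pos (pow_pos hx _) (Real.exp_pos _)
  rw [inner2C] at h
  simp_rw [hval] at h
  rw [integral_complex_ofReal, Complex.ofReal_eq_zero, setIntegral_eq_zero_iff_of_nonneg_ae
    ((ae_restrict_iff' measurableSet_Ioi).2 (Filter.Eventually.of_forall fun x hx =>
      mul_nonneg (sq_nonneg _) (hw x hx).le)) hint] at h
  by_contra hp
  have hroots : {x : ℝ | p.eval (x : ℂ) = 0}.Finite :=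
    ((Polynomial.finite_setOfPred_isRoot hp).preimage Complex.ofReal_injective.injOn)
  have hae : ∀ᵐ x : ℝ ∂volume.restrict (Ioi (0 : ℝ)), False := by
    filter_upwards [h, ae_restrict_mem measurableSet_Ioi,
      ae_restrict_of_ae (measure_eq_zero_iff_ae_notMem.1 (hroots.measure_zero volume))]
      with x hx hx0 hxr
    have := (mul_eq_zero.1 hx).resolve_right (hw x hx0).ne'
    exact hxr (by simpa using this)
  rw [ae_iff] at hae
  simp at hae

lemma inner2C_eq_zero_of_degree_lt {M N : ℕ} (hNM : N < M) {L : ℕ → ℂ[X]} (hL : IsLag M N L)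
    {n : ℕ} {q : ℂ[X]} (hq : q.degree < n) : inner2C M N (L n) q = 0 := by
  have ht : 0 < Complex.I.im := by simp
  rw [inner2C_comm, ← skew1_Tq hNM ht, ← skewBilin_apply hNM ht, q.as_sum_range_C_mul_X_pow,
    map_sum, LinearMap.sum_apply]
  refine Finset.sum_eq_zero fun i _ => ?_
  rcases lt_or_ge i n with hi | hi
  · rw [← Polynomial.smul_eq_C_mul, map_smul, LinearMap.smul_apply, skewBilin_apply,
      skew1_Tq hNM ht, inner2C_comm, (hL n).2.2 i hi, smul_zero]
  · rw [Polynomial.coeff_eq_zero_of_degree_lt (hq.trans_le (by exact_mod_cast hi))]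
    simp

/-- Polynomials of degree less than `n + 2` that are skew-orthogonal to all polynomials of degree
less than `n + 2` vanish as soon as `⟨L_{n+1}, L_n⟩₁ ≠ 0`. -/
lemma eq_zero_of_skew1_eq_zero {M N : ℕ} (hNM : N < M) {t : ℂ} (ht : 0 < t.im)
    {L : ℕ → ℂ[X]} (hL : IsLag M N L) {n : ℕ} (hne : skew1 M N t (L (n + 1)) (L n) ≠ 0)
    {p : ℂ[X]} (hp : p.degree < (n + 2 : ℕ))
    (h : ∀ q : ℂ[X], q.natDegree < n + 2 → skew1 M N t p q = 0) : p = 0 := by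
  set B := skewBilin hNM ht
  have hBL : ∀ k, B (L k) (L k) = 0 := fun k =>
    self_eq_neg.1 (skew1_antisymm hNM ht (L k) (L k))
  have hcoeff : ∀ k, (L k).coeff k = 1 := fun k => by
    simpa [Polynomial.Monic, Polynomial.leadingCoeff, (hL k).2.1] using (hL k).1
  have hcoeff0 : ∀ k m, k < m → (L k).coeff m = 0 := fun k m hkm =>
    Polynomial.coeff_eq_zero_of_natDegree_lt (by rw [(hL k).2.1]; exact hkm)
  obtain ⟨a, b, r, hr, hpr⟩ : ∃ (a b : ℂ) (r : ℂ[X]), r.degree < n ∧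
      p = a • L (n + 1) + b • L n + r := by
    refine ⟨p.coeff (n + 1), p.coeff n - p.coeff (n + 1) * (L (n + 1)).coeff n,
      p - (p.coeff (n + 1) • L (n + 1) +
        (p.coeff n - p.coeff (n + 1) * (L (n + 1)).coeff n) • L n), ?_, by ring⟩
    rw [Polynomial.degree_lt_iff_coeff_zero] at hp ⊢
    intro m hm
    simp only [Polynomial.coeff_sub, Polynomial.coeff_add, Polynomial.coeff_smul, smul_eq_mul]
    obtain rfl | rfl | hm : m = n ∨ m = n + 1 ∨ n + 2 ≤ m := by omega
    · rw [hcoeff]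
      ring
    · rw [hcoeff, hcoeff0 n _ (by omega)]
      ring
    · rw [hcoeff0 _ _ (by omega), hcoeff0 n _ (by omega), hp m hm]
      ring
  have hr0 : r = 0 := by
    refine eq_zero_of_inner2C_map_conj_eq_zero hNM ?_
    set q := r.map (starRingEnd ℂ)
    have hq : q.degree < n := by rwa [Polynomial.degree_map]
    have hpq : B p (Tq M N t q) = 0 := by
      refine h _ ?_
      rcases eq_or_ne q 0 with h0 | h0
      · simp [h0, Tq]
      · have := (Polynomial.natDegree_lt_iff_degree_lt h0).2 hq
        have := natDegree_Tq_le M N t q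
        omega
    have h₁ : B (L (n + 1)) (Tq M N t q) = 0 :=
      (skew1_Tq hNM ht _ _).trans (inner2C_eq_zero_of_degree_lt hNM hL
        (hq.trans (by exact_mod_cast n.lt_succ_self)))
    have h₂ : B (L n) (Tq M N t q) = 0 :=
      (skew1_Tq hNM ht _ _).trans (inner2C_eq_zero_of_degree_lt hNM hL hq)
    rw [← skew1_Tq hNM ht]
    change B r (Tq M N t q) = 0
    simpa [hpr, h₁, h₂] using hpq
  have hne' : B (L n) (L (n + 1)) ≠ 0 := fun h0 => hne (by
    rw [skew1_antisymm hNM ht, neg_eq_zero]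
    exact h0)
  have hne'' : B (L (n + 1)) (L n) ≠ 0 := hne
  have ha : B p (L n) = 0 := h _ (by rw [(hL n).2.1]; omega)
  have hb : B p (L (n + 1)) = 0 := h _ (by rw [(hL _).2.1]; omega)
  rw [hr0, add_zero] at hpr
  simp only [hpr, map_add, map_smul, LinearMap.add_apply, LinearMap.smul_apply, hBL, smul_eq_mul,
    mul_zero, add_zero, zero_add, mul_eq_zero, hne', hne'', or_false] at ha hb
  simp [hpr, ha, hb]

/-- The moment matrix of the skew product is invertible as soon as `⟨L_{n+1}, L_n⟩₁ ≠ 0`. -/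
lemma det_moments_ne_zero {M N : ℕ} (hNM : N < M) {t : ℂ} (ht : 0 < t.im)
    {L : ℕ → ℂ[X]} (hL : IsLag M N L) {n : ℕ} (hne : skew1 M N t (L (n + 1)) (L n) ≠ 0) :
    (Matrix.of fun j k : Fin (n + 2) =>
      skewBilin hNM ht (X ^ (j : ℕ)) (X ^ (k : ℕ))).det ≠ 0 := by
  intro hdet
  obtain ⟨v, hv, hv0⟩ := Matrix.exists_vecMul_eq_zero_iff.2 hdet
  refine hv (funext fun i => ?_)
  have hcoeff : ∀ m : ℕ, (∑ j : Fin (n + 2), v j • (X : ℂ[X]) ^ (j : ℕ)).coeff m =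
      if h : m < n + 2 then v ⟨m, h⟩ else 0 := fun m => by
    simp only [Polynomial.finsetSum_coeff, Polynomial.coeff_smul, Polynomial.coeff_X_pow,
      smul_eq_mul, mul_ite, mul_one, mul_zero]
    split_ifs with h
    · rw [Finset.sum_eq_single ⟨m, h⟩]
      · simp
      · intro j _ hj
        rw [if_neg]
        exact fun hm => hj (Fin.ext hm.symm)
      · simp
    · refine Finset.sum_eq_zero fun j _ => if_neg ?_
      have := j.2
      omega
  have hp : ∑ j : Fin (n + 2), v j • (X : ℂ[X]) ^ (j : ℕ) = 0 := by
    refine eq_zero_of_skew1_eq_zero hNM ht hL hne ?_ fun q hq => ?_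
    · rw [Polynomial.degree_lt_iff_coeff_zero]
      intro m hm
      rw [hcoeff, dif_neg (by omega)]
    · rw [← skewBilin_apply hNM ht, q.as_sum_range' _ hq, Finset.sum_range, map_sum]
      refine Finset.sum_eq_zero fun k _ => ?_
      have := congrFun hv0 k
      simp only [Matrix.vecMul, dotProduct, Matrix.of_apply, Pi.zero_apply] at this
      rw [← Polynomial.smul_X_eq_monomial, map_smul, map_sum, LinearMap.sum_apply]
      simp only [map_smul, LinearMap.smul_apply, smul_eq_mul]
      rw [this, mul_zero]
  have := hcoeff i
  rw [hp, dif_pos i.2] at this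
  exact this.symm

/-- With `t` ranging over an open set `U` in the upper half-plane on
which `⟨L_{N−1},L_{N−2}⟩₁(t)·⟨L_{N−3},L_{N−4}⟩₁(t) ≠ 0`, let `r_j(·;t)` (packaged as
`R t j`) be monic of degree `j`, independent of `t` for `j ≤ N−3`, and skew-orthogonal
(`π_{N−2,1}`, `π_{N−1,1}`) for `j = N−2, N−1`.  Let `D(t)` be the moment matrix with
entries `⟨r_j, r_k⟩₁(t)`.  Then for every `t ∈ U` the matrix `D(t)` is invertible,
`t ↦ det D(t)` is complex-differentiable at `t`, and
`(d/dt) det D(t) = −det D(t)·∫₀^∞ S₁(x,x;t)/(t−x) dx` with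
`S₁(x,x;t) = −Σ_{j,k} r_j(x;t)w(x;t)(D(t)⁻¹)_{jk}ε(r_k(·;t)w(·;t))(x)`. -/
theorem stmt_13 (M N : ℕ) (hNe : Even N) (hN : 6 ≤ N) (hNM : N < M)
    (U : Set ℂ) (hUopen : IsOpen U) (hUupper : ∀ t ∈ U, 0 < t.im)
    (L : ℕ → Polynomial ℂ) (hL : IsLag M N L)
    (hne : ∀ t ∈ U, skew1 M N t (L (N - 1)) (L (N - 2)) *
        skew1 M N t (L (N - 3)) (L (N - 4)) ≠ 0)
    (R : ℂ → ℕ → Polynomial ℂ)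
    (hRdeg : ∀ t ∈ U, ∀ j, j ≤ N - 1 → (R t j).Monic ∧ (R t j).natDegree = j)
    (hRconst : ∀ j, j ≤ N - 3 → ∀ t₁ ∈ U, ∀ t₂ ∈ U, R t₁ j = R t₂ j)
    (hRN2 : ∀ t ∈ U, ∀ j, j < N - 2 →
      skew1 M N t (R t (N - 2)) (Polynomial.X ^ j) = 0)
    (hRN1 : ∀ t ∈ U, ∀ j, j < N - 2 →
      skew1 M N t (R t (N - 1)) (Polynomial.X ^ j) = 0)
    (D : ℂ → Matrix (Fin N) (Fin N) ℂ)
    (hD : ∀ s : ℂ, D s = Matrix.of fun j k : Fin N =>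
      skew1 M N s (R s (j : ℕ)) (R s (k : ℕ))) :
    ∀ t ∈ U,
      (D t).det ≠ 0 ∧
      HasDerivAt (fun s => (D s).det)
        (-(D t).det * ∫ x in Ioi (0 : ℝ),
          (-(∑ j : Fin N, ∑ k : Fin N,
              (R t (j : ℕ)).eval (x : ℂ) * wC M N t x * (D t)⁻¹ j k *
                epsC (fun y => (R t (k : ℕ)).eval (y : ℂ) * wC M N t y) x))
            / (t - (x : ℂ))) t := by
  intro t htU
  have ht := hUupper t htU
  obtain ⟨n, rfl⟩ : ∃ n, N = n + 2 := ⟨N - 2, by omega⟩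
  have hmonic : ∀ s ∈ U, ∀ j < n + 2, (R s j).Monic ∧ (R s j).natDegree = j := fun s hs j hj =>
    hRdeg s hs j (by omega)
  have hDdet : ∀ s ∈ U, (D s).det =
      (Matrix.of fun j k : Fin (n + 2) => skew1 M (n + 2) s (R t j) (R t k)).det := fun s hs => by
    rw [hD]
    exact (det_gram_eq_of_monic (skewBilin hNM (hUupper s hs)) _ _ (hmonic s hs)).trans
      (det_gram_eq_of_monic (skewBilin hNM (hUupper s hs)) _ _ (hmonic t htU)).symm
  have hdet : (D t).det ≠ 0 := by
    rw [hD]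
    exact (det_gram_eq_of_monic (skewBilin hNM ht) _ _ (hmonic t htU)).trans_ne
      (det_moments_ne_zero hNM ht hL (left_ne_zero_of_mul (hne t htU)))
  refine ⟨hdet, ?_⟩
  have hderiv := hasDerivAt_det
    (A := fun s => Matrix.of fun j k : Fin (n + 2) => skew1 M (n + 2) s (R t j) (R t k))
    (fun j k => hasDerivAt_skew1 hNM ht (R t j) (R t k))
  refine (hderiv.congr_of_eventuallyEq (Filter.eventually_of_mem (hUopen.mem_nhds htU)
    hDdet)).congr_deriv ?_
  rw [← hD t]
  set E : Fin (n + 2) → Fin (n + 2) → ℂ := fun j k => ∫ x in Ioi (0 : ℝ),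
    (R t j).eval (x : ℂ) * wC M (n + 2) t x / (t - x) *
      epsC (fun y => (R t k).eval (y : ℂ) * wC M (n + 2) t y) x with hE
  have hint : ∫ x in Ioi (0 : ℝ), (-(∑ j : Fin (n + 2), ∑ k : Fin (n + 2),
      (R t (j : ℕ)).eval (x : ℂ) * wC M (n + 2) t x * (D t)⁻¹ j k *
        epsC (fun y => (R t (k : ℕ)).eval (y : ℂ) * wC M (n + 2) t y) x)) / (t - (x : ℂ)) =
      -∑ j, ∑ k, (D t)⁻¹ j k * E j k := by
    have hjk : ∀ j k : Fin (n + 2), Integrable (fun x : ℝ => (D t)⁻¹ j k *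
        ((R t j).eval (x : ℂ) * wC M (n + 2) t x / (t - x) *
          epsC (fun y => (R t k).eval (y : ℂ) * wC M (n + 2) t y) x))
        (volume.restrict (Ioi 0)) := fun j k =>
      (integrableOn_mul_epsC (integrableOn_eval_mul_wC_div hNM ht (R t j))
        (integrableOn_eval_mul_wC hNM ht (R t k))).const_mul _
    have hEsum : ∑ j, ∑ k, (D t)⁻¹ j k * E j k = ∫ x in Ioi (0 : ℝ),
        ∑ j : Fin (n + 2), ∑ k : Fin (n + 2), (D t)⁻¹ j k *
        ((R t j).eval (x : ℂ) * wC M (n + 2) t x / (t - x) *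
          epsC (fun y => (R t k).eval (y : ℂ) * wC M (n + 2) t y) x) := by
      rw [integral_finsetSum _ fun j _ => integrable_finsetSum _ fun k _ => hjk j k]
      refine Finset.sum_congr rfl fun j _ => ?_
      rw [integral_finsetSum _ fun k _ => hjk j k]
      exact Finset.sum_congr rfl fun k _ => (integral_const_mul _ _).symm
    rw [hEsum, ← integral_neg]
    refine integral_congr_ae (Filter.Eventually.of_forall fun x => ?_)
    dsimp only
    rw [neg_div, Finset.sum_div]
    refine congrArg _ (Finset.sum_congr rfl fun j _ => ?_)
    rw [Finset.sum_div]
    exact Finset.sum_congr rfl fun k _ => by ring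
  rw [hint]
  have hskew : ∀ j k, (D t)⁻¹ k j = -(D t)⁻¹ j k := by
    have htr : (D t).transpose = -D t := by
      ext j k
      simp only [hD, Matrix.transpose_apply, Matrix.neg_apply, Matrix.of_apply]
      exact skew1_antisymm hNM ht _ _
    have hinv : ((D t)⁻¹).transpose = -(D t)⁻¹ := by
      rw [Matrix.transpose_nonsing_inv, htr]
      refine Matrix.inv_eq_left_inv ?_
      rw [neg_mul_neg, Matrix.nonsing_inv_mul _ (isUnit_iff_ne_zero.2 hdet)]
    exact fun j k => congrFun (congrFun hinv j) k
  have hadj : (D t).adjugate = (D t).det • (D t)⁻¹ := by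
    rw [Matrix.inv_def, smul_smul, Ring.inverse_eq_inv', mul_inv_cancel₀ hdet, one_smul]
  have hswap : ∑ j, ∑ k, (D t)⁻¹ j k * E k j = -∑ j, ∑ k, (D t)⁻¹ j k * E j k := by
    rw [Finset.sum_comm, ← Finset.sum_neg_distrib]
    refine Finset.sum_congr rfl fun j _ => ?_
    rw [← Finset.sum_neg_distrib]
    exact Finset.sum_congr rfl fun k _ => by rw [hskew j k, neg_mul]
  have hsum : ∑ j, ∑ k, (D t).adjugate j k * (-(1 / 2) * (E k j - E j k)) =
      (D t).det * (-(1 / 2) * (∑ j, ∑ k, (D t)⁻¹ j k * E k j - ∑ j, ∑ k, (D t)⁻¹ j k * E j k)) := by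
    simp only [hadj, Matrix.smul_apply, smul_eq_mul, ← Finset.sum_sub_distrib, Finset.mul_sum]
    exact Finset.sum_congr rfl fun j _ => Finset.sum_congr rfl fun k _ => by ring
  refine hsum.trans ?_
  rw [hswap]
  ring
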